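/- (Genus-one Fay identity for the Kronecker function.) For all z₁, z₂, u₁, u₂ ∈ ℂ such that z₁, z₂, u₁, u₂, u₁+u₂, z₁−z₂ all lie outside the lattice Λ: φ(z₁, u₁)·φ(z₂, u₂) = φ(z₁, u₁+u₂)·φ(z₂−z₁, u₂) + φ(z₂, u₁+u₂)·φ(z₁−z₂, u₁). -/

import Mathlib

open Complex Matrix Kronecker Finset Filter Topology

noncomputable section

/-- The lattice Λ = ℤ + τℤ. -/
def Lam (τ : ℂ) : Set ℂ := {z : ℂ | ∃ m n : ℤ, z = (m : ℂ) + (n : ℂ) * τ}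

/-- The first Jacobi theta function
ϑ(z) = −∑_{j∈ℤ} exp(πi(j+1/2)²τ + 2πi(j+1/2)(z+1/2)). -/
def theta (τ : ℂ) (z : ℂ) : ℂ :=
  -∑' j : ℤ, Complex.exp ((Real.pi : ℂ) * Complex.I * ((j : ℂ) + 1 / 2) ^ 2 * τ +
      2 * (Real.pi : ℂ) * Complex.I * ((j : ℂ) + 1 / 2) * (z + 1 / 2))

/-- The first Eisenstein function E₁(u) = ϑ′(u)/ϑ(u). -/
def E1 (τ : ℂ) (u : ℂ) : ℂ := deriv (theta τ) u / theta τ u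

/-- The Kronecker function φ(z,u) = ϑ′(0)·ϑ(z+u)/(ϑ(z)·ϑ(u)). -/
def phi (τ : ℂ) (z u : ℂ) : ℂ :=
  deriv (theta τ) 0 * theta τ (z + u) / (theta τ z * theta τ u)

/-- The second Eisenstein function E₂(u) = −E₁′(u). -/
def E2 (τ : ℂ) (u : ℂ) : ℂ := -deriv (E1 τ) u

/-- The Weierstrass ℘-function: ℘(u) = E₂(u) + (1/3)·ϑ‴(0)/ϑ′(0). -/
def wp (τ : ℂ) (u : ℂ) : ℂ :=
  E2 τ u + (1 / 3) * iteratedDeriv 3 (theta τ) 0 / deriv (theta τ) 0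

theorem neg_cexp (w : ℂ) : -cexp w = cexp (w + -(Real.pi * I)) := by
  rw [Complex.exp_add, Complex.exp_neg, Complex.exp_pi_mul_I]
  norm_num

theorem theta_eq (τ z : ℂ) : theta τ z =
    -(cexp (Real.pi * I * τ / 4 + Real.pi * I * (z + 1 / 2)) *
      jacobiTheta₂ (z + 1 / 2 + τ / 2) τ) := by
  rw [theta, jacobiTheta₂, ← tsum_mul_left]
  congr 1
  refine tsum_congr fun j => ?_
  rw [jacobiTheta₂_term, ← Complex.exp_add]
  congr 1
  ring

theorem theta_differentiable (τ : ℂ) (hτ : 0 < τ.im) : Differentiable ℂ (theta τ) := by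
  have : theta τ = fun z => -(cexp (Real.pi * I * τ / 4 + Real.pi * I * (z + 1 / 2)) *
      jacobiTheta₂ (z + 1 / 2 + τ / 2) τ) := funext (theta_eq τ)
  rw [this]
  intro z
  have h1 := (differentiableAt_jacobiTheta₂_fst (z + 1 / 2 + τ / 2) hτ)
  have h2 : DifferentiableAt ℂ (fun z : ℂ => jacobiTheta₂ (z + 1 / 2 + τ / 2) τ) z :=
    DifferentiableAt.comp (f := fun z : ℂ => z + 1 / 2 + τ / 2) z h1 (by fun_prop)
  fun_prop

theorem theta_add_one (τ z : ℂ) : theta τ (z + 1) = -theta τ z := by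
  rw [theta_eq, theta_eq]
  have : z + 1 + 1 / 2 + τ / 2 = (z + 1 / 2 + τ / 2) + 1 := by ring
  rw [this, jacobiTheta₂_add_left]
  have : (Real.pi : ℂ) * I * τ / 4 + Real.pi * I * (z + 1 + 1 / 2) =
    (Real.pi * I * τ / 4 + Real.pi * I * (z + 1 / 2)) + Real.pi * I := by ring
  rw [this, Complex.exp_add, Complex.exp_pi_mul_I]
  ring

theorem theta_add_tau (τ z : ℂ) : theta τ (z + τ) =
    -(cexp (-Real.pi * I * τ - 2 * Real.pi * I * z) * theta τ z) := by
  rw [theta_eq, theta_eq]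
  have : z + τ + 1 / 2 + τ / 2 = (z + 1 / 2 + τ / 2) + τ := by ring
  rw [this, jacobiTheta₂_add_left']
  have h : cexp ((Real.pi : ℂ) * I * τ / 4 + Real.pi * I * (z + τ + 1 / 2)) *
      cexp (-Real.pi * I * (τ + 2 * (z + 1 / 2 + τ / 2))) =
      -(cexp (-Real.pi * I * τ - 2 * Real.pi * I * z) *
      cexp (Real.pi * I * τ / 4 + Real.pi * I * (z + 1 / 2))) := by
    rw [← Complex.exp_add, ← Complex.exp_add, neg_cexp]
    congr 1
    ring
  linear_combination (-jacobiTheta₂ (z + 1 / 2 + τ / 2) τ) * h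

theorem theta_neg (τ z : ℂ) : theta τ (-z) = -theta τ z := by
  rw [theta_eq, theta_eq]
  have : -z + 1 / 2 + τ / 2 = -((z - 1 / 2 - τ / 2)) := by ring
  rw [this, jacobiTheta₂_neg_left]
  have : z + 1 / 2 + τ / 2 = (z - 1 / 2 - τ / 2) + 1 + τ := by ring
  rw [this, jacobiTheta₂_add_left', jacobiTheta₂_add_left]
  have h : cexp ((Real.pi : ℂ) * I * τ / 4 + Real.pi * I * (z + 1 / 2)) *
      cexp (-Real.pi * I * (τ + 2 * (z - 1 / 2 - τ / 2 + 1))) =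
      -(cexp (Real.pi * I * τ / 4 + Real.pi * I * (-z + 1 / 2))) := by
    rw [← Complex.exp_add, neg_cexp]
    congr 1
    ring
  linear_combination (-jacobiTheta₂ (z - 1 / 2 - τ / 2) τ) * h

theorem theta_ne (τ : ℂ) (hτ : 0 < τ.im) : ∃ z, theta τ z ≠ 0 := by
  by_contra! H
  have H' : ∀ w, jacobiTheta₂ w τ = 0 := by
    intro w
    have := H (w - 1 / 2 - τ / 2)
    rw [theta_eq] at this
    have e : w - 1 / 2 - τ / 2 + 1 / 2 + τ / 2 = w := by ring
    rw [e] at this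
    simpa using this
  have hs := intervalIntegral.hasSum_integral_of_dominated_convergence
    (μ := MeasureTheory.volume) (a := 0) (b := 1)
    (F := fun (n : ℤ) (x : ℝ) => jacobiTheta₂_term n (x : ℂ) τ) (f := fun _ => (0 : ℂ))
    (fun n _ => ‖jacobiTheta₂_term n 0 τ‖)
    (fun n => by
      apply Continuous.aestronglyMeasurable
      unfold jacobiTheta₂_term
      fun_prop)
    (fun n => Eventually.of_forall fun x _ => by
      rw [norm_jacobiTheta₂_term, norm_jacobiTheta₂_term]; simp)
    (Eventually.of_forall fun x _ => ((summable_jacobiTheta₂_term_iff 0 τ).2 hτ).norm)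
    (by simp)
    (Eventually.of_forall fun x _ => by
      have := hasSum_jacobiTheta₂_term (x : ℂ) hτ
      rwa [H'] at this)
  have hi : ∀ n : ℤ, n ≠ 0 → ∫ x in (0:ℝ)..1, jacobiTheta₂_term n (x : ℂ) τ = 0 := by
    intro n hn
    have hc : 2 * (Real.pi : ℂ) * I * n ≠ 0 := by
      simp [Real.pi_ne_zero, hn]
    simp_rw [jacobiTheta₂_term, Complex.exp_add]
    rw [intervalIntegral.integral_mul_const, integral_exp_mul_complex hc]
    have : cexp (2 * (Real.pi : ℂ) * I * n * (1:ℝ)) = 1 := by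
      rw [Complex.exp_eq_one_iff]
      exact ⟨n, by push_cast; ring⟩
    rw [this]; simp
  have h1 := (hasSum_single 0 hi).unique hs
  simp [jacobiTheta₂_term] at h1

def thA (τ x : ℂ) : ℂ := jacobiTheta₂ (2 * x) (2 * τ)
def thB (τ x : ℂ) : ℂ :=
  cexp (Real.pi * I * τ / 2 + 2 * Real.pi * I * x) * jacobiTheta₂ (2 * x + τ) (2 * τ)

theorem theta_mul (τ : ℂ) (hτ : 0 < τ.im) (x y : ℂ) :
    theta τ (x + y) * theta τ (x - y) = thA τ x * thB τ y - thB τ x * thA τ y := by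
  have hτ2 : 0 < (2 * τ).im := by simpa using hτ
  set t : ℂ → ℤ → ℂ := fun z j => cexp ((Real.pi : ℂ) * I * ((j : ℂ) + 1 / 2) ^ 2 * τ +
      2 * (Real.pi : ℂ) * I * ((j : ℂ) + 1 / 2) * (z + 1 / 2)) with ht
  set e : ℂ → ℤ → ℂ := fun x m => jacobiTheta₂_term m (2 * x) (2 * τ) with he
  set o : ℂ → ℤ → ℂ := fun x m => cexp (Real.pi * I * τ / 2 + 2 * Real.pi * I * x) *
    jacobiTheta₂_term m (2 * x + τ) (2 * τ) with ho
  have hts : ∀ z, Summable (t z) := by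
    intro z
    have := ((summable_jacobiTheta₂_term_iff (z + 1 / 2 + τ / 2) τ).2 hτ).mul_left
      (cexp (Real.pi * I * τ / 4 + Real.pi * I * (z + 1 / 2)))
    refine this.congr fun j => ?_
    simp only [ht]
    rw [jacobiTheta₂_term, ← Complex.exp_add]
    congr 1
    ring
  have hes : ∀ z, HasSum (e z) (thA τ z) := fun z => hasSum_jacobiTheta₂_term _ hτ2
  have hos : ∀ z, HasSum (o z) (thB τ z) := fun z =>
    (hasSum_jacobiTheta₂_term _ hτ2).mul_left _
  have hprod : ∀ (f g : ℤ → ℂ) (a b : ℂ), HasSum f a → HasSum g b →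
      HasSum (fun p : ℤ × ℤ => f p.1 * g p.2) (a * b) := by
    intro f g a b hf hg
    exact hf.mul hg (summable_mul_of_summable_norm hf.summable.norm hg.summable.norm)
  have hL : theta τ (x + y) * theta τ (x - y) = (∑' j, t (x + y) j) * ∑' j, t (x - y) j := by
    simp only [theta, ht, neg_mul_neg]
  have h1 := hprod _ _ _ _ (hts (x + y)).hasSum (hts (x - y)).hasSum
  rw [hL]
  refine h1.unique ?_
  let i1 : ℤ × ℤ → ℤ × ℤ := fun p => (p.1 + p.2, p.1 - p.2 - 1)
  let i2 : ℤ × ℤ → ℤ × ℤ := fun p => (p.1 + p.2, p.1 - p.2)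
  have hi1 : Function.Injective i1 := by
    rintro ⟨a, b⟩ ⟨c, d⟩ h
    simp only [i1, Prod.mk.injEq] at h ⊢
    omega
  have hi2 : Function.Injective i2 := by
    rintro ⟨a, b⟩ ⟨c, d⟩ h
    simp only [i2, Prod.mk.injEq] at h ⊢
    omega
  have hc : IsCompl (Set.range i1) (Set.range i2) := by
    rw [isCompl_iff, Set.disjoint_iff, codisjoint_iff]
    constructor
    · rintro p ⟨⟨⟨a, b⟩, rfl⟩, ⟨⟨c, d⟩, h⟩⟩
      simp only [i1, i2, Prod.mk.injEq] at h
      omega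
    · refine Set.eq_univ_of_forall ?_
      rintro ⟨j, k⟩
      rcases Int.even_or_odd' (j - k) with ⟨r, h | h⟩
      · right
        exact ⟨(j - r, r), by simp only [i2, Prod.mk.injEq]; omega⟩
      · left
        exact ⟨(j - r, r), by simp only [i1, Prod.mk.injEq]; omega⟩
  have hA := hprod _ _ _ _ (hes x) (hos y)
  have hB := (hprod _ _ _ _ (hos x) (hes y)).neg
  rw [sub_eq_add_neg (thA τ x * thB τ y)]
  refine HasSum.add_isCompl (f := fun p : ℤ × ℤ => t (x + y) p.1 * t (x - y) p.2) hc
    (hi1.hasSum_range_iff (f := fun p : ℤ × ℤ => t (x + y) p.1 * t (x - y) p.2).2 ?_)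
    (hi2.hasSum_range_iff (f := fun p : ℤ × ℤ => t (x + y) p.1 * t (x - y) p.2).2 ?_)
  · convert hA using 1
    funext p
    simp only [Function.comp, i1, ht, he, ho, jacobiTheta₂_term, ← Complex.exp_add]
    rw [Complex.exp_eq_exp_iff_exists_int]
    exact ⟨p.1, by push_cast; ring⟩
  · have hB' : HasSum (fun p : ℤ × ℤ => -(o x p.1 * e y p.2)) (-(thB τ x * thA τ y)) := hB
    refine Eq.subst (motive := fun f => HasSum f (-(thB τ x * thA τ y))) (funext fun p => ?_) hB'
    symm
    simp only [Function.comp, i2, ht, he, ho, jacobiTheta₂_term, ← Complex.exp_add]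
    rw [← neg_one_mul, ← Complex.exp_pi_mul_I, ← Complex.exp_add,
      Complex.exp_eq_exp_iff_exists_int]
    exact ⟨p.1, by push_cast; ring⟩

theorem theta_weierstrass (τ : ℂ) (hτ : 0 < τ.im) (x y z w : ℂ) :
    theta τ (x + y) * theta τ (x - y) * (theta τ (z + w) * theta τ (z - w)) +
    theta τ (x + z) * theta τ (x - z) * (theta τ (w + y) * theta τ (w - y)) +
    theta τ (x + w) * theta τ (x - w) * (theta τ (y + z) * theta τ (y - z)) = 0 := by
  simp only [theta_mul τ hτ]
  ring

theorem theta_key (τ : ℂ) (hτ : 0 < τ.im) (a : ℂ) (ha : theta τ a = 0) (p q p' q' : ℂ)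
    (h : p + q = p' + q') :
    theta τ (p + a) * theta τ (q + a) * (theta τ p' * theta τ q') =
    theta τ (p' + a) * theta τ (q' + a) * (theta τ p * theta τ q) := by
  have W := theta_weierstrass τ hτ ((p + q) / 2 + a) ((p + q) / 2) ((p - q) / 2) ((p' - q') / 2)
  have e1 : (p + q) / 2 + a - (p + q) / 2 = a := by ring
  have e2 : (p + q) / 2 + a + (p - q) / 2 = p + a := by ring
  have e3 : (p + q) / 2 + a - (p - q) / 2 = q + a := by ring
  have e4 : (p' - q') / 2 + (p + q) / 2 = p' := by rw [h]; ring
  have e5 : (p' - q') / 2 - (p + q) / 2 = -q' := by rw [h]; ring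
  have e6 : (p + q) / 2 + a + (p' - q') / 2 = p' + a := by rw [h]; ring
  have e7 : (p + q) / 2 + a - (p' - q') / 2 = q' + a := by rw [h]; ring
  have e8 : (p + q) / 2 + (p - q) / 2 = p := by ring
  have e9 : (p + q) / 2 - (p - q) / 2 = q := by ring
  rw [e1, e2, e3, e4, e5, e6, e7, e8, e9, ha, theta_neg] at W
  linear_combination -W

theorem theta_wr (τ : ℂ) (hτ : 0 < τ.im) (a : ℂ) (ha : theta τ a = 0) (p q : ℂ) :
    theta τ q * theta τ (q + a) *
      (deriv (theta τ) (p + a) * theta τ p - theta τ (p + a) * deriv (theta τ) p) =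
    theta τ p * theta τ (p + a) *
      (deriv (theta τ) (q + a) * theta τ q - theta τ (q + a) * deriv (theta τ) q) := by
  have hd : ∀ z, HasDerivAt (theta τ) (deriv (theta τ) z) z := fun z =>
    (theta_differentiable τ hτ z).hasDerivAt
  have hp : ∀ c : ℂ, HasDerivAt (fun t : ℂ => theta τ (c + t)) (deriv (theta τ) c) 0 := by
    intro c
    have := (hd (c + 0)).comp_const_add c 0
    simpa using this
  have hq : ∀ c : ℂ, HasDerivAt (fun t : ℂ => theta τ (c - t)) (-deriv (theta τ) c) 0 := by
    intro c
    have := (hd (c - 0)).comp_const_sub c 0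
    simpa using this
  have h1 := ((hp p).mul (hq q)).const_mul (theta τ (p + a) * theta τ (q + a))
  have h2 := ((hp (p + a)).mul (hq (q + a))).mul_const (theta τ p * theta τ q)
  have he : (fun t : ℂ => theta τ (p + a) * theta τ (q + a) *
        (theta τ (p + t) * theta τ (q - t))) =
      fun t : ℂ => theta τ (p + a + t) * theta τ (q + a - t) * (theta τ p * theta τ q) := by
    funext t
    have := theta_key τ hτ a ha p q (p + t) (q - t) (by ring)
    rw [this]
    congr 3 <;> ring
  have h3 : HasDerivAt (fun t : ℂ => theta τ (p + a) * theta τ (q + a) *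
        (theta τ (p + t) * theta τ (q - t))) _ 0 := h1
  rw [he] at h3
  have := h3.unique h2
  simp only [add_zero, sub_zero] at this
  linear_combination -this

theorem wr_zero (f h : ℂ → ℂ) (hf : Differentiable ℂ f) (hh : Differentiable ℂ h) (q : ℂ)
    (hq : f q ≠ 0) (hw : ∀ p, deriv h p * f p - h p * deriv f p = 0) :
    ∃ C, ∀ p, h p = C * f p := by
  refine ⟨h q / f q, fun p => ?_⟩
  have hev : ∀ᶠ z in 𝓝 q, f z ≠ 0 := hf.continuous.continuousAt.eventually_ne hq
  obtain ⟨r, hr, hb⟩ := Metric.eventually_nhds_iff_ball.1 hev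
  have hE : h =ᶠ[𝓝 q] fun z => h q / f q * f z := by
    filter_upwards [Metric.ball_mem_nhds q hr] with z hz
    have := Metric.isOpen_ball.is_const_of_deriv_eq_zero (𝕜 := ℂ) (f := fun z => h z / f z)
      (s := Metric.ball q r) (convex_ball q r).isPreconnected
      (fun w hw' => ((hh w).div (hf w) (hb w hw')).differentiableWithinAt)
      (fun w hw' => by
        rw [deriv_fun_div (hh w) (hf w) (hb w hw'), hw w]; simp) hz (Metric.mem_ball_self hr)
    rw [← this]
    field_simp [hb z hz]
  have hA : ∀ g : ℂ → ℂ, Differentiable ℂ g → AnalyticOnNhd ℂ g Set.univ := fun g hg =>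
    hg.differentiableOn.analyticOnNhd isOpen_univ
  exact congrFun ((hA h hh).eq_of_eventuallyEq (hA _ (hf.const_mul _)) hE) p

theorem theta_zero (τ : ℂ) (hτ : 0 < τ.im) (a : ℂ) (ha : theta τ a = 0) : a ∈ Lam τ := by
  have hd := theta_differentiable τ hτ
  have hda : Differentiable ℂ (fun z => theta τ (z + a)) := by
    intro z
    exact ((hd (z + a)).hasDerivAt.comp_add_const z a).differentiableAt
  have hA : ∀ g : ℂ → ℂ, Differentiable ℂ g → AnalyticOnNhd ℂ g Set.univ := fun g hg =>
    hg.differentiableOn.analyticOnNhd isOpen_univ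
  obtain ⟨z0, hz0⟩ := theta_ne τ hτ
  obtain ⟨q, hq⟩ : ∃ q, theta τ q * theta τ (q + a) ≠ 0 := by
    by_contra! H
    rcases (hA _ hd).eq_zero_or_eq_zero_of_mul_eq_zero (hA _ hda) (fun z _ => H z)
      isPreconnected_univ with h | h
    · exact hz0 (h z0 trivial)
    · have := h (z0 - a) trivial
      rw [sub_add_cancel] at this
      exact hz0 this
  have hq1 : theta τ q ≠ 0 := left_ne_zero_of_mul hq
  have hq2 : theta τ (q + a) ≠ 0 := right_ne_zero_of_mul hq
  set l : ℂ := (deriv (theta τ) (q + a) * theta τ q - theta τ (q + a) * deriv (theta τ) q) /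
    (theta τ q * theta τ (q + a)) with hl
  have hw : ∀ p, deriv (theta τ) (p + a) * theta τ p - theta τ (p + a) * deriv (theta τ) p =
      l * (theta τ p * theta τ (p + a)) := by
    intro p
    have := theta_wr τ hτ a ha p q
    rw [hl, div_mul_eq_mul_div, eq_div_iff hq]
    linear_combination this
  have hH : ∀ p, HasDerivAt (fun z => theta τ (z + a) * cexp (-l * z))
      (deriv (theta τ) (p + a) * cexp (-l * p) + theta τ (p + a) * (cexp (-l * p) * -l)) p := by
    intro p
    have h1 : HasDerivAt (fun z => theta τ (z + a)) (deriv (theta τ) (p + a)) p :=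
      (hd (p + a)).hasDerivAt.comp_add_const p a
    have h2 : HasDerivAt (fun z : ℂ => -l * z) (-l) p := by
      simpa using (hasDerivAt_id p).const_mul (-l)
    exact h1.mul h2.cexp
  obtain ⟨C, hC⟩ := wr_zero (theta τ) (fun z => theta τ (z + a) * cexp (-l * z)) hd
    (fun p => (hH p).differentiableAt) q hq1 (fun p => by
      rw [(hH p).deriv]
      linear_combination cexp (-l * p) * hw p)
  have hC' : ∀ p, theta τ (p + a) = C * theta τ p * cexp (l * p) := by
    intro p
    rw [← hC p, mul_assoc, ← Complex.exp_add]
    simp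
  have hC0 : C ≠ 0 := by
    rintro rfl
    apply hq2
    rw [hC']; simp
  have hCq : C * theta τ q * cexp (l * q) ≠ 0 := by
    rw [← hC']; exact hq2
  have k1 : cexp l = 1 := by
    have h := hC' (q + 1)
    have e : q + 1 + a = (q + a) + 1 := by ring
    rw [e, theta_add_one, theta_add_one, hC', mul_add, Complex.exp_add, mul_one] at h
    apply mul_left_cancel₀ hCq
    linear_combination h
  have k2 : cexp (l * τ + 2 * Real.pi * I * a) = 1 := by
    have h := hC' (q + τ)
    have e : q + τ + a = (q + a) + τ := by ring
    have e2 : -(Real.pi : ℂ) * I * τ - 2 * Real.pi * I * (q + a) =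
      (-Real.pi * I * τ - 2 * Real.pi * I * q) + (- (2 * Real.pi * I * a)) := by ring
    rw [e, theta_add_tau, theta_add_tau, hC', mul_add l, Complex.exp_add (l * q), e2,
      Complex.exp_add _ (- (2 * Real.pi * I * a))] at h
    have h5 : cexp (l * τ) = cexp (-(2 * Real.pi * I * a)) := by
      apply mul_left_cancel₀ (mul_ne_zero hCq
        (Complex.exp_ne_zero (-Real.pi * I * τ - 2 * Real.pi * I * q)))
      linear_combination h
    rw [Complex.exp_add, h5, ← Complex.exp_add]
    simp
  obtain ⟨n, hn⟩ := Complex.exp_eq_one_iff.1 k1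
  obtain ⟨m, hm⟩ := Complex.exp_eq_one_iff.1 k2
  refine ⟨m, -n, ?_⟩
  have hpi : 2 * (Real.pi : ℂ) * I ≠ 0 := Complex.two_pi_I_ne_zero
  apply mul_left_cancel₀ hpi
  rw [hn] at hm
  push_cast
  linear_combination hm

/-- the genus-one Fay identity for the Kronecker function:
φ(z₁,u₁)·φ(z₂,u₂) = φ(z₁,u₁+u₂)·φ(z₂−z₁,u₂) + φ(z₂,u₁+u₂)·φ(z₁−z₂,u₁). -/
theorem fay_identity (τ : ℂ) (hτ : 0 < τ.im) (z₁ z₂ u₁ u₂ : ℂ)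
    (hz₁ : z₁ ∉ Lam τ) (hz₂ : z₂ ∉ Lam τ) (hu₁ : u₁ ∉ Lam τ) (hu₂ : u₂ ∉ Lam τ)
    (hu₁₂ : u₁ + u₂ ∉ Lam τ) (hz₁₂ : z₁ - z₂ ∉ Lam τ) :
    phi τ z₁ u₁ * phi τ z₂ u₂ =
      phi τ z₁ (u₁ + u₂) * phi τ (z₂ - z₁) u₂ +
        phi τ z₂ (u₁ + u₂) * phi τ (z₁ - z₂) u₁ := by
  have n1 : theta τ z₁ ≠ 0 := fun h => hz₁ (theta_zero τ hτ _ h)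
  have n2 : theta τ z₂ ≠ 0 := fun h => hz₂ (theta_zero τ hτ _ h)
  have n3 : theta τ u₁ ≠ 0 := fun h => hu₁ (theta_zero τ hτ _ h)
  have n4 : theta τ u₂ ≠ 0 := fun h => hu₂ (theta_zero τ hτ _ h)
  have n5 : theta τ (u₁ + u₂) ≠ 0 := fun h => hu₁₂ (theta_zero τ hτ _ h)
  have n6 : theta τ (z₁ - z₂) ≠ 0 := fun h => hz₁₂ (theta_zero τ hτ _ h)
  have e0 : theta τ (z₂ - z₁) = -theta τ (z₁ - z₂) := by
    rw [← theta_neg, neg_sub]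
  have W := theta_weierstrass τ hτ ((z₁ + u₁ + z₂ + u₂) / 2) ((z₁ + u₁ - z₂ - u₂) / 2)
    ((u₁ + u₂ + z₂ - z₁) / 2) ((u₁ + u₂ - z₂ + z₁) / 2)
  have e1 : (z₁ + u₁ + z₂ + u₂) / 2 + (z₁ + u₁ - z₂ - u₂) / 2 = z₁ + u₁ := by ring
  have e2 : (z₁ + u₁ + z₂ + u₂) / 2 - (z₁ + u₁ - z₂ - u₂) / 2 = z₂ + u₂ := by ring
  have e3 : (u₁ + u₂ + z₂ - z₁) / 2 + (u₁ + u₂ - z₂ + z₁) / 2 = u₁ + u₂ := by ring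
  have e4 : (u₁ + u₂ + z₂ - z₁) / 2 - (u₁ + u₂ - z₂ + z₁) / 2 = z₂ - z₁ := by ring
  have e5 : (z₁ + u₁ + z₂ + u₂) / 2 + (u₁ + u₂ + z₂ - z₁) / 2 = z₂ + (u₁ + u₂) := by ring
  have e6 : (z₁ + u₁ + z₂ + u₂) / 2 - (u₁ + u₂ + z₂ - z₁) / 2 = z₁ := by ring
  have e7 : (u₁ + u₂ - z₂ + z₁) / 2 + (z₁ + u₁ - z₂ - u₂) / 2 = z₁ - z₂ + u₁ := by ring
  have e8 : (u₁ + u₂ - z₂ + z₁) / 2 - (z₁ + u₁ - z₂ - u₂) / 2 = u₂ := by ring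
  have e9 : (z₁ + u₁ + z₂ + u₂) / 2 + (u₁ + u₂ - z₂ + z₁) / 2 = z₁ + (u₁ + u₂) := by ring
  have e10 : (z₁ + u₁ + z₂ + u₂) / 2 - (u₁ + u₂ - z₂ + z₁) / 2 = z₂ := by ring
  have e11 : (z₁ + u₁ - z₂ - u₂) / 2 + (u₁ + u₂ + z₂ - z₁) / 2 = u₁ := by ring
  have e12 : (z₁ + u₁ - z₂ - u₂) / 2 - (u₁ + u₂ + z₂ - z₁) / 2 = -(z₂ - z₁ + u₂) := by ring
  rw [e1, e2, e3, e4, e5, e6, e7, e8, e9, e10, e11, e12, e0, theta_neg] at W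
  unfold phi
  rw [e0]
  generalize deriv (theta τ) 0 = D at *
  generalize theta τ (z₁ + u₁) = A1 at *
  generalize theta τ (z₂ + u₂) = A2 at *
  generalize theta τ (z₁ + (u₁ + u₂)) = A3 at *
  generalize theta τ (z₂ + (u₁ + u₂)) = A4 at *
  generalize theta τ (z₂ - z₁ + u₂) = A5 at *
  generalize theta τ (z₁ - z₂ + u₁) = A6 at *
  generalize theta τ (z₁ - z₂) = B6 at *
  generalize theta τ (u₁ + u₂) = B5 at *
  generalize theta τ z₁ = B1 at *
  generalize theta τ z₂ = B2 at *
  generalize theta τ u₁ = B3 at *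
  generalize theta τ u₂ = B4 at *
  have : D * A1 / (B1 * B3) * (D * A2 / (B2 * B4)) -
      (D * A3 / (B1 * B5) * (D * A5 / (-B6 * B4)) + D * A4 / (B2 * B5) * (D * A6 / (B6 * B3))) =
      D ^ 2 / (B1 * B2 * B3 * B4 * B5 * B6) *
        (A1 * A2 * B5 * B6 + A3 * A5 * B2 * B3 - A4 * A6 * B1 * B4) := by
    field_simp
    ring
  rw [← sub_eq_zero, this]
  have h0 : A1 * A2 * B5 * B6 + A3 * A5 * B2 * B3 - A4 * A6 * B1 * B4 = 0 := by
    linear_combination -W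
  rw [h0, mul_zero]

end
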